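/- arXiv:math/0703757 — 2 statements merged into one kernel-verified Lean document; each statement's English description precedes it below -/
import Mathlib

section
/- If I ⊂ S is a monomial ideal of Borel type, then every associated prime P ∈ Ass(S/I) is of the form P = (x_1,...,x_r) for some 1 ≤ r ≤ n. -/
/-! Monomials in `S = K[x_1,…,x_n]` are identified with their exponent vectors in
`Fin n →₀ ℕ` (0-indexed: the variable `x_j` of the paper is index `j-1`).
A monomial ideal is identified with its set `M` of exponent vectors of monomials. -/

/-- `M` is the set of exponent vectors of the monomials of a monomial ideal:
it is closed under multiplication by arbitrary monomials. -/
def MonIdeal {n : ℕ} (M : Set (Fin n →₀ ℕ)) : Prop :=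
  ∀ u ∈ M, ∀ v : Fin n →₀ ℕ, u + v ∈ M

/-- The Borel type condition: for every monomial `u ∈ I` and `j < i` with `x_i ∣ u`
there is `t > 0` with `x_j^t · u / x_i^{ν_i(u)} ∈ I`. -/
def BorelProp {n : ℕ} (M : Set (Fin n →₀ ℕ)) : Prop :=
  ∀ u ∈ M, ∀ i j : Fin n, j < i → u i ≠ 0 →
    ∃ t : ℕ, 0 < t ∧ Finsupp.single j t + Finsupp.update u i 0 ∈ M

/-- `i = m(u)`, the largest index of a variable dividing the monomial `u`. -/
def IsMaxVar {n : ℕ} (u : Fin n →₀ ℕ) (i : Fin n) : Prop :=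
  u i ≠ 0 ∧ ∀ k : Fin n, i < k → u k = 0

/-- `M` is stable: for every monomial `u ∈ M` and `j < m(u)`, `x_j · u / x_{m(u)} ∈ M`. -/
def StableProp {n : ℕ} (M : Set (Fin n →₀ ℕ)) : Prop :=
  ∀ u ∈ M, ∀ i : Fin n, IsMaxVar u i → ∀ j : Fin n, j < i →
    Finsupp.single j 1 + Finsupp.update u i (u i - 1) ∈ M

/-- degree of a monomial. -/
def mdeg {n : ℕ} (u : Fin n →₀ ℕ) : ℕ := ∑ k : Fin n, u k

/-- `u` is a minimal monomial generator of `M` (divisibility of monomials is `≤`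
of exponent vectors). -/
def MinGen {n : ℕ} (M : Set (Fin n →₀ ℕ)) (u : Fin n →₀ ℕ) : Prop :=
  u ∈ M ∧ ∀ v ∈ M, v ≤ u → v = u

/-- `deg(I)`: the maximal degree of a minimal monomial generator. -/
noncomputable def idealDeg {n : ℕ} (M : Set (Fin n →₀ ℕ)) : ℕ :=
  sSup {d | ∃ u, MinGen M u ∧ mdeg u = d}

/-- `I_{≥ e}`: the ideal generated by all monomials of `I` of degree `≥ e`. -/
def geSet {n : ℕ} (M : Set (Fin n →₀ ℕ)) (e : ℕ) : Set (Fin n →₀ ℕ) :=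
  {w | ∃ u ∈ M, e ≤ mdeg u ∧ u ≤ w}

/-- the product of two monomial ideals (on the level of monomials). -/
def prodSet {n : ℕ} (M N : Set (Fin n →₀ ℕ)) : Set (Fin n →₀ ℕ) :=
  {w | ∃ u ∈ M, ∃ v ∈ N, w = u + v}

/-- The Castelnuovo–Mumford regularity of a monomial ideal of Borel type: by
[Cimpoeas, Cor. 8] / Theorem 1.5, `reg(I) = min { e ≥ deg I : I_{≥e} is stable }`. -/
noncomputable def regSet {n : ℕ} (M : Set (Fin n →₀ ℕ)) : ℕ :=
  sInf {e | idealDeg M ≤ e ∧ StableProp (geSet M e)}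

/-- `q` (0-indexed) is the largest index with `x_q ∈ √I`. -/
def IsQ {n : ℕ} (M : Set (Fin n →₀ ℕ)) (q : Fin n) : Prop :=
  (∃ k : ℕ, 0 < k ∧ Finsupp.single q k ∈ M) ∧
    ∀ j : Fin n, (∃ k : ℕ, 0 < k ∧ Finsupp.single j k ∈ M) → j ≤ q

namespace MvPolynomial

variable {σ K : Type*} [Field K]

theorem mem_span_monomial_image_iff_of_isUpperSet {M : Set (σ →₀ ℕ)} (hM : IsUpperSet M)
    {g : MvPolynomial σ K} :
    g ∈ Ideal.span ((fun u => monomial u (1 : K)) '' M) ↔ ∀ m ∈ g.support, m ∈ M := by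
  rw [mem_ideal_span_monomial_image]
  exact forall₂_congr fun m _ => ⟨fun ⟨s, hs, hsm⟩ => hM hsm hs, fun h => ⟨m, h, le_rfl⟩⟩

theorem monomial_mem_span_monomial_image {M : Set (σ →₀ ℕ)} (hM : IsUpperSet M)
    {u : σ →₀ ℕ} {c : K} (hc : c ≠ 0) :
    monomial u c ∈ Ideal.span ((fun u => monomial u (1 : K)) '' M) ↔ u ∈ M := by
  classical
  rw [mem_span_monomial_image_iff_of_isUpperSet hM, support_monomial, if_neg hc]
  simp

theorem support_sub_monomial_coeff [DecidableEq σ] (f : MvPolynomial σ K) (v : σ →₀ ℕ) :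
    (f - monomial v (f.coeff v)).support = f.support.erase v := by
  ext w
  by_cases h : v = w
  · subst h; simp
  · simp [coeff_monomial, h, Ne.symm h]

theorem exists_X_mem_of_monomial_mem {P : Ideal (MvPolynomial σ K)} (hP : P.IsPrime)
    {u : σ →₀ ℕ} {c : K} (hc : c ≠ 0) (h : monomial u c ∈ P) :
    ∃ i, X i ∈ P ∧ u i ≠ 0 := by
  rw [monomial_eq] at h
  rcases hP.mem_or_mem h with h | h
  · exact (hP.ne_top (P.eq_top_of_isUnit_mem h ((isUnit_iff_ne_zero.mpr hc).map C))).elim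
  · obtain ⟨i, hi, h⟩ := hP.prod_mem_iff.mp h
    exact ⟨i, hP.mem_of_pow_mem _ h, Finsupp.mem_support_iff.mp hi⟩

/-- A prime ideal of the form `(I : f)` with `I` a monomial ideal is also of this form with `f`
replaced by a polynomial all of whose terms have the same colon ideal on monomials. -/
theorem exists_colon_eq_forall_monomial_mem_iff {M : Set (σ →₀ ℕ)} (hM : IsUpperSet M)
    {P : Ideal (MvPolynomial σ K)} (hP : P.IsPrime) (f : MvPolynomial σ K)
    (hf : ∀ g, g ∈ P ↔ g * f ∈ Ideal.span ((fun u => monomial u (1 : K)) '' M)) :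
    ∃ f' : MvPolynomial σ K,
      (∀ g, g ∈ P ↔ g * f' ∈ Ideal.span ((fun u => monomial u (1 : K)) '' M)) ∧
      ∀ v ∈ f'.support, ∀ w, monomial w (1 : K) ∈ P ↔ w + v ∈ M := by
  classical
  induction h : f.support.card using Nat.strong_induction_on generalizing f with
  | _ k ih =>
  by_cases hex : ∃ v ∈ f.support, ∃ w, monomial w (1 : K) ∉ P ∧ w + v ∈ M
  · obtain ⟨v, hv, w, hw, hwv⟩ := hex
    set f₁ := f - monomial v (f.coeff v) with hf₁
    have hcard : (monomial w (1 : K) * f₁).support.card < k := by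
      calc _ ≤ f₁.support.card := by
            refine (Finset.card_le_card (support_mul _ _)).trans ?_
            rw [support_monomial, if_neg one_ne_zero, Finset.singleton_add]
            exact Finset.card_image_le
        _ < k := by
            rw [hf₁, support_sub_monomial_coeff, ← h]
            exact Finset.card_erase_lt_of_mem hv
    refine ih _ hcard _ (fun g => ?_) rfl
    have hdrop : g * (monomial w 1 * f) - g * (monomial w 1 * f₁) ∈
        Ideal.span ((fun u => monomial u (1 : K)) '' M) := by
      have : g * (monomial w 1 * f) - g * (monomial w 1 * f₁) =
          g * monomial (w + v) (f.coeff v) := by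
        rw [hf₁, ← one_mul (f.coeff v), ← monomial_mul, one_mul]; ring
      rw [this]
      exact Ideal.mul_mem_left _ _
        ((monomial_mem_span_monomial_image hM (mem_support_iff.mp hv)).mpr hwv)
    have hg : g * (monomial w 1 * f) ∈ Ideal.span ((fun u => monomial u (1 : K)) '' M) ↔
        g * (monomial w 1 * f₁) ∈ Ideal.span ((fun u => monomial u (1 : K)) '' M) :=
      ⟨fun h => (Submodule.sub_mem_iff_right _ h).mp hdrop,
        fun h => (Submodule.sub_mem_iff_left _ h).mp hdrop⟩
    rw [← hg, ← mul_assoc, ← hf]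
    exact ⟨fun h => P.mul_mem_right _ h, fun h => (hP.mem_or_mem h).resolve_right hw⟩
  · push Not at hex
    refine ⟨f, hf, fun v hv w => ⟨fun hw => ?_, fun hwv => ?_⟩⟩
    · have := (mem_span_monomial_image_iff_of_isUpperSet hM).mp ((hf _).mp hw)
      refine this _ ?_
      rw [mem_support_iff, coeff_monomial_mul, one_mul]
      exact mem_support_iff.mp hv
    · by_contra hw
      exact hex v hv w hw hwv

theorem exists_monomial_mem_iff_and_le_span_X (m : MonomialOrder σ) {M : Set (σ →₀ ℕ)}
    (hM : IsUpperSet M) {P : Ideal (MvPolynomial σ K)} (hP : P.IsPrime) (f : MvPolynomial σ K)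
    (hf : ∀ g, g ∈ P ↔ g * f ∈ Ideal.span ((fun u => monomial u (1 : K)) '' M)) :
    (∃ v, ∀ w, monomial w (1 : K) ∈ P ↔ w + v ∈ M) ∧
      P ≤ Ideal.span (X '' {i | (X i : MvPolynomial σ K) ∈ P}) := by
  classical
  obtain ⟨f, hf, hfv⟩ := exists_colon_eq_forall_monomial_mem_iff hM hP f hf
  have hf0 : f ≠ 0 := by
    rintro rfl
    exact hP.ne_top ((Ideal.eq_top_iff_one _).mpr ((hf 1).mpr (by simp)))
  have hlead : ∀ g : MvPolynomial σ K, g ≠ 0 → m.degree g ∈ g.support := fun g hg =>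
    mem_support_iff.mpr (m.coeff_degree_ne_zero_iff.mpr hg)
  refine ⟨⟨m.degree f, hfv _ (hlead f hf0)⟩, fun g hg => ?_⟩
  induction h : g.support.card using Nat.strong_induction_on generalizing g with
  | _ k ih =>
  by_cases hg0 : g = 0
  · simp [hg0]
  have hmem : monomial (m.degree g) (1 : K) ∈ P := by
    rw [hfv _ (hlead f hf0), ← m.degree_mul hg0 hf0]
    exact (mem_span_monomial_image_iff_of_isUpperSet hM).mp ((hf g).mp hg) _
      (hlead _ (mul_ne_zero hg0 hf0))
  set t := monomial (m.degree g) (g.coeff (m.degree g)) with ht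
  have htP : t ∈ P := by
    rw [ht, ← mul_one (g.coeff _), ← C_mul_monomial]
    exact P.mul_mem_left _ hmem
  have htX : t ∈ Ideal.span (X '' {i | (X i : MvPolynomial σ K) ∈ P}) := by
    obtain ⟨i, hi, hi0⟩ := exists_X_mem_of_monomial_mem hP one_ne_zero hmem
    rw [mem_ideal_span_X_image]
    intro u hu
    obtain rfl := Finset.mem_singleton.mp (support_monomial_subset hu)
    exact ⟨i, hi, hi0⟩
  have hsub := ih _ (by
    rw [ht, support_sub_monomial_coeff, ← h]
    exact Finset.card_erase_lt_of_mem (hlead g hg0)) (g - t) (P.sub_mem hg htP) rfl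
  simpa using add_mem hsub htX

end MvPolynomial

open MvPolynomial in
/-- every associated prime of `S/I`, for `I ≠ 0` of Borel type, has the
form `(x_1,…,x_r)` for some `1 ≤ r ≤ n`. -/
theorem statement6 {K : Type*} [Field K] {n : ℕ} (M : Set (Fin n →₀ ℕ))
    (hM : MonIdeal M) (hB : BorelProp M) (hM0 : M.Nonempty)
    (I : Ideal (MvPolynomial (Fin n) K))
    (hI : I = Ideal.span ((fun u => monomial u (1 : K)) '' M))
    (P : Ideal (MvPolynomial (Fin n) K))
    (hP : P ∈ associatedPrimes (MvPolynomial (Fin n) K) (MvPolynomial (Fin n) K ⧸ I)) :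
    ∃ r : ℕ, 1 ≤ r ∧ r ≤ n ∧
      P = Ideal.span {p | ∃ i : Fin n, (i : ℕ) < r ∧ p = (X i : MvPolynomial (Fin n) K)} := by
  have hU : IsUpperSet M := fun a b hab ha => by
    simpa [add_tsub_cancel_of_le hab] using hM a ha (b - a)
  obtain ⟨hPp, x, hx⟩ := isAssociatedPrime_iff.mp hP
  obtain ⟨f, rfl⟩ := Ideal.Quotient.mk_surjective x
  have hf : ∀ g, g ∈ P ↔ g * f ∈ Ideal.span ((fun u => monomial u (1 : K)) '' M) := fun g => by
    rw [hx, Submodule.mem_colon_singleton, Submodule.mem_bot, ← hI,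
      ← Ideal.Quotient.eq_zero_iff_mem]
    rfl
  obtain ⟨⟨v, hv⟩, hle⟩ :=
    exists_monomial_mem_iff_and_le_span_X MonomialOrder.lex hU hPp f hf
  have hdown : ∀ i j : Fin n, j < i → (X i : MvPolynomial (Fin n) K) ∈ P →
      (X j : MvPolynomial (Fin n) K) ∈ P := fun i j hji hi => by
    obtain ⟨t, -, ht⟩ := hB _ ((hv (Finsupp.single i 1)).mp hi) i j hji (by simp)
    refine hPp.mem_of_pow_mem t ?_
    rw [X_pow_eq_monomial, hv]
    refine hU (add_le_add_right (fun k => ?_) _) ht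
    by_cases hk : k = i
    · simp [hk]
    · simp [Finsupp.update_apply, hk]
  obtain ⟨u, hu⟩ := hM0
  obtain ⟨i₀, hi₀, -⟩ := exists_X_mem_of_monomial_mem hPp one_ne_zero
    ((hv u).mpr (hM u hu v))
  obtain ⟨i, hi, hmax⟩ := (Set.toFinite {i : Fin n | (X i : MvPolynomial (Fin n) K) ∈ P}).exists_maximal
    ⟨i₀, hi₀⟩
  refine ⟨i + 1, by omega, by omega, le_antisymm (hle.trans (Ideal.span_mono ?_))
    (Ideal.span_le.mpr ?_)⟩
  · rintro _ ⟨j, hj, rfl⟩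
    have : j ≤ i := (le_total j i).elim id fun h => hmax hj h
    exact ⟨j, Nat.lt_succ_of_le this, rfl⟩
  · rintro _ ⟨j, hj, rfl⟩
    rcases (show j ≤ i from Nat.le_of_lt_succ hj).eq_or_lt with rfl | h
    · exact hi
    · exact hdown i j h hi
end

section
/- Let I ⊂ S be a monomial ideal of Borel type, q = max{ j : x_j ∈ √I }, and for i ≥ 1 let r_i be the number of minimal monomial generators u of I with m(u) = q + i. If r_i = 0 for some 0 ≤ i ≤ n − q − 1, then r_{i+1} = 0. -/
/-- Every monomial of `M` is divisible by a minimal generator. -/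
theorem exists_minGen_le {n : ℕ} {M : Set (Fin n →₀ ℕ)} {w : Fin n →₀ ℕ} (hw : w ∈ M) :
    ∃ v, MinGen M v ∧ v ≤ w := by
  obtain ⟨v, hvw, hv⟩ := exists_minimal_le_of_wellFoundedLT (· ∈ M) w hw
  exact ⟨v, ⟨hv.prop, fun x hx hxv => hv.eq_of_le hx hxv⟩, hvw⟩

/-- If a minimal generator has maximal variable `b`, then some minimal generator has maximal
variable `a`, the predecessor of `b`. -/
theorem BorelProp.exists_minGen_isMaxVar {n : ℕ} {M : Set (Fin n →₀ ℕ)} (hB : BorelProp M)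
    {a b : Fin n} (hab : (b : ℕ) = a + 1) {u : Fin n →₀ ℕ} (hu : MinGen M u)
    (hub : IsMaxVar u b) : ∃ v, MinGen M v ∧ IsMaxVar v a := by
  obtain ⟨t, -, hw⟩ := hB u hu.1 b a (Fin.lt_def.2 (by omega)) hub.1
  obtain ⟨v, hv, hvw⟩ := exists_minGen_le hw
  have hle : ∀ k, k ≠ a → v k ≤ Function.update u b 0 k := fun k hk => by
    simpa [Finsupp.single_apply, hk.symm] using hvw k
  have hvb : v b = 0 := by
    simpa using hle b (by rintro rfl; omega)
  refine ⟨v, hv, fun hva => ?_, fun k hk => ?_⟩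
  · have hvu : v ≤ u := fun k => by
      by_cases hka : k = a
      · simp [hka, hva]
      by_cases hkb : k = b
      · simp [hkb, hvb]
      simpa [hkb] using hle k hka
    exact hub.1 (hu.2 v hv.1 hvu ▸ hvb)
  · by_cases hkb : k = b
    · rw [hkb, hvb]
    have hbk : b < k := by
      rw [Fin.lt_def] at hk ⊢
      have := Fin.val_ne_of_ne hkb
      omega
    simpa [hkb, hub.2 k hbk] using hle k hk.ne'

/-- with `q = max{j : x_j ∈ √I}` and `r_i` the number of minimal
generators `u` with `m(u) = q + i` (here 0-indexed: `m(u)` at index `q.val + i`),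
if `r_i = 0` for some `0 ≤ i ≤ n - q - 1` then `r_{i+1} = 0`. -/
theorem statement13 {n : ℕ} (M : Set (Fin n →₀ ℕ))
    (hM : MonIdeal M) (hB : BorelProp M) (q : Fin n) (hq : IsQ M q)
    (i : ℕ) (hi : (q : ℕ) + i + 1 < n)
    (h0 : ¬ ∃ u, MinGen M u ∧ IsMaxVar u ⟨(q : ℕ) + i, by omega⟩) :
    ¬ ∃ u, MinGen M u ∧ IsMaxVar u ⟨(q : ℕ) + i + 1, hi⟩ := by
  rintro ⟨u, hu, hub⟩
  exact h0 (hB.exists_minGen_isMaxVar rfl hu hub)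
end
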